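/- Let α ∈ Δ, s = s_α, and w ∈ W with ℓ(sw) < ℓ(w). Then N¹(sw) is contained in the set {s(β) : β ∈ N¹(w) \ {α}} ∪ {f_α(β) : β ∈ N¹(w) \ {α}}, where for each β ∈ Φ⁺ \ {α}, f_α(β) denotes the positive root such that {α, f_α(β)} is the canonical basis of the maximal rank 2 root subsystem Φ ∩ P, P being the plane spanned by α and β. -/

import Mathlib

section RootSystemDefs

variable {S : Type*} {W : Type*} [Group W]

/-- The simple root `α_s` in the vector space `V = S → ℝ`. -/
def simpleRoot [DecidableEq S] (s : S) : S → ℝ := Pi.single s 1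

/-- The symmetric bilinear form `B` on `V = S → ℝ` with `B(α_s, α_t) = -cos (π / m s t)`
(with the convention that `B(α_s, α_t) = -1` when `m s t = ∞`, which is encoded by
`Mmat s t = 0`). -/
noncomputable def bform [Fintype S] (Mmat : CoxeterMatrix S) (v u : S → ℝ) : ℝ :=
  ∑ s : S, ∑ t : S,
    v s * u t * (if Mmat s t = 0 then -1 else -Real.cos (Real.pi / (Mmat s t : ℝ)))

/-- The conic closure of `X`: all nonnegative linear combinations of elements of `X`. -/
def coneOf {V : Type*} [AddCommMonoid V] [Module ℝ V] (X : Set V) : Set V :=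
  {v | ∃ (n : ℕ) (c : Fin n → ℝ) (x : Fin n → V),
    (∀ i, 0 ≤ c i) ∧ (∀ i, x i ∈ X) ∧ v = ∑ i, c i • x i}

variable [Fintype S] [DecidableEq S] {Mmat : CoxeterMatrix S}

/-- The root system `Φ = W(Δ)`, for the representation `ρ` of `W` on `V = S → ℝ`. -/
def rootSet (ρ : W →* ((S → ℝ) ≃ₗ[ℝ] (S → ℝ))) : Set (S → ℝ) :=
  {v | ∃ (w : W) (s : S), v = ρ w (simpleRoot s)}

/-- The positive roots `Φ⁺ = cone(Δ) ∩ Φ`. -/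
def posRoots (ρ : W →* ((S → ℝ) ≃ₗ[ℝ] (S → ℝ))) : Set (S → ℝ) :=
  coneOf (Set.range (simpleRoot (S := S))) ∩ rootSet ρ

/-- The negative roots `Φ⁻ = -Φ⁺`. -/
def negRoots (ρ : W →* ((S → ℝ) ≃ₗ[ℝ] (S → ℝ))) : Set (S → ℝ) :=
  {v | -v ∈ posRoots ρ}

/-- Dominance order: `Dominates ρ a b` means `a ≼ b`, i.e. every `w ∈ W` sending `b` to a
negative root also sends `a` to a negative root. -/
def Dominates (ρ : W →* ((S → ℝ) ≃ₗ[ℝ] (S → ℝ))) (a b : S → ℝ) : Prop :=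
  ∀ w : W, ρ w b ∈ negRoots ρ → ρ w a ∈ negRoots ρ

/-- A small root: a positive root dominating no positive root other than itself. -/
def IsSmallRoot (ρ : W →* ((S → ℝ) ≃ₗ[ℝ] (S → ℝ))) (b : S → ℝ) : Prop :=
  b ∈ posRoots ρ ∧ ∀ a ∈ posRoots ρ, Dominates ρ a b → a = b

/-- `t : W` is the reflection `s_b` in the root `b`: it acts on `V` by
`v ↦ v - 2 B(b, v) b`. -/
def IsReflIn (Mmat : CoxeterMatrix S) (ρ : W →* ((S → ℝ) ≃ₗ[ℝ] (S → ℝ)))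
    (t : W) (b : S → ℝ) : Prop :=
  ∀ v : S → ℝ, ρ t v = v - (2 * bform Mmat b v) • b

/-- The (left) inversion set `N(w) = Φ⁺ ∩ w(Φ⁻)`. -/
def invSet (ρ : W →* ((S → ℝ) ≃ₗ[ℝ] (S → ℝ))) (w : W) : Set (S → ℝ) :=
  {b | b ∈ posRoots ρ ∧ ρ w⁻¹ b ∈ negRoots ρ}

/-- `N¹(w) = {α ∈ Φ⁺ : ℓ(s_α w) = ℓ(w) - 1}`. -/
def nOne (cs : CoxeterSystem Mmat W) (ρ : W →* ((S → ℝ) ≃ₗ[ℝ] (S → ℝ)))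
    (w : W) : Set (S → ℝ) :=
  {b | b ∈ posRoots ρ ∧
    ∃ t : W, IsReflIn Mmat ρ t b ∧ cs.length (t * w) + 1 = cs.length w}

/-- A low element of `W`: an element `w` with `N¹(w) ⊆ Σ`. -/
def IsLow (cs : CoxeterSystem Mmat W) (ρ : W →* ((S → ℝ) ≃ₗ[ℝ] (S → ℝ)))
    (w : W) : Prop :=
  ∀ b ∈ nOne cs ρ w, IsSmallRoot ρ b

end RootSystemDefs

section SimpleRoots

variable {S : Type*} [DecidableEq S]

lemma simpleRoot_nonneg (s : S) : 0 ≤ simpleRoot s := by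
  intro i
  by_cases h : i = s <;> simp [simpleRoot, h]

lemma eq_smul_simpleRoot {s : S} {v : S → ℝ} (hv : ∀ i, i ≠ s → v i = 0) :
    v = v s • simpleRoot s := by
  ext i
  by_cases h : i = s
  · simp [h, simpleRoot]
  · simp [hv i h, simpleRoot, h]

end SimpleRoots

section BilinearForm

variable {S : Type*} [Fintype S] {M : CoxeterMatrix S}

lemma bform_add_right (v x y : S → ℝ) : bform M v (x + y) = bform M v x + bform M v y := by
  simp only [bform, Pi.add_apply, mul_add, add_mul, Finset.sum_add_distrib]

lemma bform_smul_right (v x : S → ℝ) (a : ℝ) : bform M v (a • x) = a * bform M v x := by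
  simp only [bform, Pi.smul_apply, smul_eq_mul, Finset.mul_sum]
  exact Finset.sum_congr rfl fun i _ => Finset.sum_congr rfl fun j _ => by ring

lemma bform_comm (v x : S → ℝ) : bform M v x = bform M x v := by
  simp only [bform]
  rw [Finset.sum_comm]
  refine Finset.sum_congr rfl fun i _ => Finset.sum_congr rfl fun j _ => ?_
  rw [M.symmetric i j]
  ring

lemma bform_smul_left (x v : S → ℝ) (a : ℝ) : bform M (a • x) v = a * bform M x v := by
  rw [bform_comm, bform_smul_right, bform_comm v]

lemma bform_neg_left (x v : S → ℝ) : bform M (-x) v = -bform M x v := by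
  rw [← neg_one_smul ℝ x, bform_smul_left, neg_one_mul]

lemma bform_sub_right (v x y : S → ℝ) : bform M v (x - y) = bform M v x - bform M v y := by
  rw [sub_eq_add_neg, ← neg_one_smul ℝ y, bform_add_right, bform_smul_right]
  ring

lemma bform_sub_left (x y v : S → ℝ) : bform M (x - y) v = bform M x v - bform M y v := by
  rw [bform_comm, bform_sub_right, bform_comm v, bform_comm v]

variable [DecidableEq S]

lemma bform_simpleRoot (s t : S) : bform M (simpleRoot s) (simpleRoot t) =
    if M s t = 0 then -1 else -Real.cos (Real.pi / (M s t : ℝ)) := by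
  simp only [bform, simpleRoot]
  rw [Finset.sum_eq_single s, Finset.sum_eq_single t]
  · simp
  · intro j _ hj
    simp [hj]
  · simp
  · intro i _ hi
    simp [hi]
  · simp

lemma bform_simpleRoot_self (s : S) : bform M (simpleRoot s) (simpleRoot s) = 1 := by
  simp [bform_simpleRoot]

lemma mem_coneOf_range_simpleRoot {v : S → ℝ} :
    v ∈ coneOf (Set.range (simpleRoot (S := S))) ↔ 0 ≤ v := by
  constructor
  · rintro ⟨n, c, x, hc, hx, rfl⟩
    refine Finset.sum_nonneg fun i _ => ?_
    obtain ⟨s, hs⟩ := hx i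
    rw [← hs]
    exact smul_nonneg (hc i) (simpleRoot_nonneg s)
  · intro hv
    let e := (Fintype.equivFin S).symm
    refine ⟨Fintype.card S, fun i => v (e i), fun i => simpleRoot (e i), fun i => hv _,
      fun i => ⟨_, rfl⟩, ?_⟩
    rw [e.sum_comp (fun s => v s • simpleRoot s)]
    ext j
    simp [simpleRoot, Pi.single_apply, Finset.sum_apply]

end BilinearForm

lemma mem_coneOf_pair {V : Type*} [AddCommGroup V] [Module ℝ V] {a c v : V} :
    v ∈ coneOf {a, c} ↔ ∃ p q : ℝ, 0 ≤ p ∧ 0 ≤ q ∧ v = p • a + q • c := by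
  constructor
  · rintro ⟨n, k, x, hk, hx, rfl⟩
    induction n with
    | zero => exact ⟨0, 0, le_rfl, le_rfl, by simp⟩
    | succ n ih =>
      obtain ⟨p, q, hp, hq, h⟩ := ih (fun i => k i.succ) (fun i => x i.succ)
        (fun i => hk _) (fun i => hx _)
      rw [Fin.sum_univ_succ, h]
      rcases hx 0 with h0 | h0
      · exact ⟨k 0 + p, q, add_nonneg (hk 0) hp, hq, by rw [h0]; module⟩
      · rw [Set.mem_singleton_iff] at h0
        exact ⟨p, k 0 + q, hp, add_nonneg (hk 0) hq, by rw [h0]; module⟩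
  · rintro ⟨p, q, hp, hq, rfl⟩
    refine ⟨2, ![p, q], ![a, c], ?_, ?_, by simp [Fin.sum_univ_two]⟩ <;>
      intro i <;> fin_cases i <;> simp [hp, hq]

section DihedralCoefficients

variable {S : Type*} (M : CoxeterMatrix S)

/-- The coefficients of the roots of the dihedral subsystem spanned by two simple roots. -/
noncomputable def dihedralCoeff (s t : S) (k : ℕ) : ℝ :=
  if M s t = 0 then k else Real.sin (k * (Real.pi / M s t)) / Real.sin (Real.pi / M s t)

lemma dihedralCoeff_comm (s t : S) (k : ℕ) : dihedralCoeff M s t k = dihedralCoeff M t s k := by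
  simp only [dihedralCoeff, M.symmetric s t]

lemma sin_pi_div_pos {s t : S} (hst : s ≠ t) (h0 : M s t ≠ 0) :
    0 < Real.sin (Real.pi / M s t) := by
  have h1 := M.off_diagonal s t hst
  have h2 : (2 : ℝ) ≤ M s t := by exact_mod_cast (show 2 ≤ M s t by omega)
  apply Real.sin_pos_of_pos_of_lt_pi
  · have := Real.pi_pos
    positivity
  · exact div_lt_self Real.pi_pos (by linarith)

lemma dihedralCoeff_zero (s t : S) : dihedralCoeff M s t 0 = 0 := by
  simp [dihedralCoeff]

lemma dihedralCoeff_one {s t : S} (hst : s ≠ t) : dihedralCoeff M s t 1 = 1 := by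
  unfold dihedralCoeff
  split_ifs with h0
  · simp
  · simp [(sin_pi_div_pos M hst h0).ne']

lemma dihedralCoeff_add_two [Fintype S] [DecidableEq S] (s t : S) (k : ℕ) :
    dihedralCoeff M s t (k + 2) =
    -2 * bform M (simpleRoot s) (simpleRoot t) * dihedralCoeff M s t (k + 1)
      - dihedralCoeff M s t k := by
  rw [bform_simpleRoot]
  unfold dihedralCoeff
  split_ifs with h0
  · push_cast
    ring
  · set θ := Real.pi / (M s t : ℝ)
    have h : Real.sin ((k + 2 : ℕ) * θ) =
        2 * Real.cos θ * Real.sin ((k + 1 : ℕ) * θ) - Real.sin (k * θ) := by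
      have e1 : ((k + 2 : ℕ) : ℝ) * θ = (k + 1 : ℕ) * θ + θ := by push_cast; ring
      have e2 : (k : ℝ) * θ = (k + 1 : ℕ) * θ - θ := by push_cast; ring
      rw [e1, e2, Real.sin_add, Real.sin_sub]
      ring
    rw [h]
    ring

lemma dihedralCoeff_nonneg {s t : S} (hst : s ≠ t) {k : ℕ} (hk : M s t = 0 ∨ k ≤ M s t) :
    0 ≤ dihedralCoeff M s t k := by
  unfold dihedralCoeff
  split_ifs with h0
  · positivity
  · have hk := hk.resolve_left h0
    have hm : (0 : ℝ) < M s t := by exact_mod_cast Nat.pos_of_ne_zero h0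
    refine div_nonneg (Real.sin_nonneg_of_nonneg_of_le_pi ?_ ?_) (sin_pi_div_pos M hst h0).le
    · have := Real.pi_pos
      positivity
    · rw [← mul_div_assoc, div_le_iff₀ hm, mul_comm]
      exact mul_le_mul_of_nonneg_left (by exact_mod_cast hk) Real.pi_pos.le

end DihedralCoefficients

section Factorization

variable {S : Type*} {M : CoxeterMatrix S} {W : Type*} [Group W]

section

variable {ρ : W →* ((S → ℝ) ≃ₗ[ℝ] (S → ℝ))}

lemma rep_mul_apply (g h : W) (v : S → ℝ) : ρ (g * h) v = ρ g (ρ h v) := by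
  rw [map_mul, LinearEquiv.mul_apply]

lemma rep_inv_apply_self (g : W) (v : S → ℝ) : ρ g⁻¹ (ρ g v) = v := by
  rw [← rep_mul_apply, inv_mul_cancel, map_one]
  rfl

lemma rep_apply_inv_self (g : W) (v : S → ℝ) : ρ g (ρ g⁻¹ v) = v := by
  rw [← rep_mul_apply, mul_inv_cancel, map_one]
  rfl

end

lemma exists_alternatingWord_factorization (cs : CoxeterSystem M W) {w : W} {s t : S}
    (hs : cs.length w < cs.length (w * cs.simple s))
    (ht : cs.length (w * cs.simple t) < cs.length w) :
    ∃ (v : W) (k : ℕ), w = v * cs.wordProd (CoxeterSystem.alternatingWord s t k) ∧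
      cs.length v < cs.length w ∧ (M s t = 0 ∨ k < M s t) ∧
      cs.length v < cs.length (v * cs.simple s) ∧ cs.length v < cs.length (v * cs.simple t) := by
  let Q : ℕ → Prop := fun k => ∃ v, w = v * cs.wordProd (CoxeterSystem.alternatingWord s t k) ∧
      cs.length w = cs.length v + k
  have hword (k : ℕ) : cs.length (cs.wordProd (CoxeterSystem.alternatingWord s t k)) ≤ k := by
    simpa using cs.length_wordProd_le (CoxeterSystem.alternatingWord s t k)
  have hdown (k : ℕ) (h : Q (k + 1)) : Q k := by
    obtain ⟨v, hv, hl⟩ := h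
    rw [CoxeterSystem.alternatingWord_succ', CoxeterSystem.wordProd_cons, ← mul_assoc] at hv
    refine ⟨_, hv, ?_⟩
    have h1 := cs.length_mul_le (v * cs.simple (if Even k then t else s))
      (cs.wordProd (CoxeterSystem.alternatingWord s t k))
    rw [← hv] at h1
    have h2 := hword k
    have h3 := cs.length_mul_simple v (if Even k then t else s)
    omega
  have hanti {j k : ℕ} (hjk : j ≤ k) (h : Q k) : Q j := by
    induction hjk with
    | refl => exact h
    | step _ ih => exact ih (hdown _ h)
  have hbdd : BddAbove {k | Q k} := ⟨cs.length w, fun k ⟨v, _, hv⟩ => by omega⟩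
  have hQ1 : Q 1 := by
    refine ⟨w * cs.simple t, by simp [CoxeterSystem.alternatingWord], ?_⟩
    have := cs.length_mul_simple w t
    omega
  have hmem : Q (sSup {k | Q k}) := Nat.sSup_mem ⟨1, hQ1⟩ hbdd
  have hmax : ∀ k, Q k → k ≤ sSup {k | Q k} := fun k hk => le_csSup hbdd hk
  generalize sSup {k | Q k} = k at hmem hmax
  obtain ⟨j, rfl⟩ : ∃ j, k = j + 1 := ⟨k - 1, by have := hmax 1 hQ1; omega⟩
  obtain ⟨v, hv, hl⟩ := id hmem
  have hnext : cs.length v < cs.length (v * cs.simple (if Even (j + 1) then t else s)) := by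
    by_contra hcon
    have h3 := cs.length_mul_simple v (if Even (j + 1) then t else s)
    have : Q (j + 1 + 1) := by
      refine ⟨v * cs.simple (if Even (j + 1) then t else s), ?_, by omega⟩
      rw [CoxeterSystem.alternatingWord_succ' s t (j + 1), CoxeterSystem.wordProd_cons,
        ← mul_assoc, CoxeterSystem.simple_mul_simple_cancel_right]
      exact hv
    have := hmax _ this
    omega
  have hprev : cs.length v < cs.length (v * cs.simple (if Even j then t else s)) := by
    by_contra hcon
    have h3 := cs.length_mul_simple v (if Even j then t else s)
    rw [CoxeterSystem.alternatingWord_succ', CoxeterSystem.wordProd_cons, ← mul_assoc] at hv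
    have h1 := cs.length_mul_le (v * cs.simple (if Even j then t else s))
      (cs.wordProd (CoxeterSystem.alternatingWord s t j))
    rw [← hv] at h1
    have h2 := hword j
    omega
  refine ⟨v, j + 1, hv, by omega, ?_, ?_⟩
  · by_contra! hcon
    obtain ⟨h0, hle⟩ := hcon
    obtain ⟨u, hu, hlu⟩ := hanti hle hmem
    have hb := cs.prod_alternatingWord_eq_prod_alternatingWord_sub s t (M s t) (by omega)
    obtain ⟨m, hm⟩ : ∃ m, M s t = m + 1 := ⟨M s t - 1, by omega⟩
    rw [show M s t * 2 - M s t = m + 1 by omega] at hb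
    rw [hb, CoxeterSystem.alternatingWord_succ, CoxeterSystem.wordProd_concat] at hu
    have h1 := cs.length_mul_le u (cs.wordProd (CoxeterSystem.alternatingWord s t m))
    have h2 := hword m
    have h3 : w * cs.simple s = u * cs.wordProd (CoxeterSystem.alternatingWord s t m) := by
      rw [hu, ← mul_assoc, CoxeterSystem.simple_mul_simple_cancel_right]
    rw [h3] at hs
    omega
  · by_cases hj : Even j
    · have hj1 : ¬ Even (j + 1) := by simpa [Nat.even_add_one] using hj
      simp only [hj, hj1, if_true, if_false] at hnext hprev
      exact ⟨hnext, hprev⟩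
    · have hj1 : Even (j + 1) := by simpa [Nat.even_add_one] using hj
      simp only [hj, hj1, if_true, if_false] at hnext hprev
      exact ⟨hprev, hnext⟩

end Factorization

section Positivity

variable {S : Type*} [Fintype S] [DecidableEq S] {M : CoxeterMatrix S} {W : Type*} [Group W]

/-- `ρ` is the standard geometric representation of the Coxeter system `cs`. -/
def IsGeometricRep (cs : CoxeterSystem M W) (ρ : W →* ((S → ℝ) ≃ₗ[ℝ] (S → ℝ))) : Prop :=
  ∀ (s : S) (v : S → ℝ),
    ρ (cs.simple s) v = v - (2 * bform M (simpleRoot s) v) • simpleRoot s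

variable {cs : CoxeterSystem M W} {ρ : W →* ((S → ℝ) ≃ₗ[ℝ] (S → ℝ))}

lemma rep_simple_self (hρ : IsGeometricRep cs ρ) (s : S) :
    ρ (cs.simple s) (simpleRoot s) = -simpleRoot s := by
  rw [hρ, bform_simpleRoot_self]
  module

lemma rep_alternatingWord (hρ : IsGeometricRep cs ρ) (k : ℕ) : ∀ {s t : S}, s ≠ t →
    ρ (cs.wordProd (CoxeterSystem.alternatingWord s t k)) (simpleRoot s) =
      dihedralCoeff M s t (if Even k then k + 1 else k) • simpleRoot s +
      dihedralCoeff M s t (if Even k then k else k + 1) • simpleRoot t := by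
  induction k using Nat.twoStepInduction with
  | zero =>
    intro s t hst
    simp [CoxeterSystem.alternatingWord, dihedralCoeff_zero, dihedralCoeff_one M hst]
  | one =>
    intro s t hst
    have h2 := dihedralCoeff_add_two M s t 0
    simp only [zero_add, dihedralCoeff_zero, dihedralCoeff_one M hst] at h2
    simp only [CoxeterSystem.alternatingWord, List.concat_eq_append, List.nil_append,
      CoxeterSystem.wordProd_singleton, Nat.not_even_one, if_false, dihedralCoeff_one M hst,
      Nat.reduceAdd, h2]
    rw [hρ, bform_comm]
    module
  | more k ih0 ih1 =>
    intro s t hst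
    have e : ρ (cs.wordProd (CoxeterSystem.alternatingWord s t (k + 2))) (simpleRoot s) =
        (-2 * bform M (simpleRoot s) (simpleRoot t)) •
          ρ (cs.wordProd (CoxeterSystem.alternatingWord t s (k + 1))) (simpleRoot t)
        - ρ (cs.wordProd (CoxeterSystem.alternatingWord s t k)) (simpleRoot s) := by
      rw [CoxeterSystem.alternatingWord_succ s t (k + 1), CoxeterSystem.wordProd_concat,
        rep_mul_apply, hρ, bform_comm, map_sub, map_smul]
      have : ρ (cs.wordProd (CoxeterSystem.alternatingWord t s (k + 1))) (simpleRoot s) =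
          -ρ (cs.wordProd (CoxeterSystem.alternatingWord s t k)) (simpleRoot s) := by
        rw [CoxeterSystem.alternatingWord_succ, CoxeterSystem.wordProd_concat, rep_mul_apply,
          rep_simple_self hρ, map_neg]
      rw [this]
      module
    rw [e, ih0 hst, ih1 hst.symm]
    simp only [dihedralCoeff_comm M t s]
    have h2 := dihedralCoeff_add_two M s t k
    have h3 := dihedralCoeff_add_two M s t (k + 1)
    by_cases hk : Even k
    · have hk1 : ¬ Even (k + 1) := by simpa [Nat.even_add_one] using hk
      have hk2 : Even (k + 2) := by simpa [Nat.even_add] using hk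
      simp only [hk, hk1, hk2, if_true, if_false]
      rw [show k + 2 + 1 = k + 1 + 2 from rfl, h3, show k + 1 + 1 = k + 2 from rfl, h2]
      module
    · have hk1 : Even (k + 1) := by simpa [Nat.even_add_one] using hk
      have hk2 : ¬ Even (k + 2) := by simpa [Nat.even_add] using hk
      simp only [hk, hk1, hk2, if_true, if_false]
      rw [show k + 2 + 1 = k + 1 + 2 from rfl, h3, show k + 1 + 1 = k + 2 from rfl, h2]
      module

/-- If `ℓ(w s) > ℓ(w)` then `w(α_s)` is nonnegative. -/
lemma rep_simpleRoot_nonneg (hρ : IsGeometricRep cs ρ) : ∀ (n : ℕ) (w : W) (s : S),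
    cs.length w = n → cs.length w < cs.length (w * cs.simple s) → 0 ≤ ρ w (simpleRoot s) := by
  intro n
  induction n using Nat.strong_induction_on with
  | _ n ih =>
    intro w s hn hs
    by_cases hw : w = 1
    · subst hw
      simpa using simpleRoot_nonneg s
    obtain ⟨t, ht⟩ := cs.exists_rightDescent_of_ne_one hw
    have hst : s ≠ t := by
      rintro rfl
      exact absurd ht (not_lt.mpr hs.le)
    obtain ⟨v, k, hv, hlt, hk, hvs, hvt⟩ := exists_alternatingWord_factorization cs hs ht
    rw [hv, rep_mul_apply, rep_alternatingWord hρ k hst, map_add, map_smul, map_smul]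
    have hk' (j : ℕ) (hj : j ≤ k + 1) : M s t = 0 ∨ j ≤ M s t := hk.imp id fun h => by omega
    refine add_nonneg
      (smul_nonneg (dihedralCoeff_nonneg M hst (hk' _ ?_)) (ih _ (hn ▸ hlt) v s rfl hvs))
      (smul_nonneg (dihedralCoeff_nonneg M hst (hk' _ ?_)) (ih _ (hn ▸ hlt) v t rfl hvt)) <;>
      split_ifs <;> omega

lemma root_nonneg_or_nonpos (hρ : IsGeometricRep cs ρ) {b : S → ℝ} (hb : b ∈ rootSet ρ) :
    0 ≤ b ∨ b ≤ 0 := by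
  obtain ⟨w, s, rfl⟩ := hb
  rcases cs.length_mul_simple w s with h | h
  · exact Or.inl (rep_simpleRoot_nonneg hρ _ w s rfl (by omega))
  · right
    have := rep_simpleRoot_nonneg hρ _ (w * cs.simple s) s rfl
      (by rw [CoxeterSystem.simple_mul_simple_cancel_right]; omega)
    rw [rep_mul_apply, rep_simple_self hρ, map_neg] at this
    exact neg_nonneg.mp this

end Positivity

section Roots

variable {S : Type*} {M : CoxeterMatrix S} {W : Type*} [Group W]
  {ρ : W →* ((S → ℝ) ≃ₗ[ℝ] (S → ℝ))}

lemma simpleRoot_mem_rootSet [DecidableEq S] (s : S) : simpleRoot s ∈ rootSet ρ := ⟨1, s, by simp⟩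

lemma rep_mem_rootSet [DecidableEq S] (w : W) {b : S → ℝ} (hb : b ∈ rootSet ρ) :
    ρ w b ∈ rootSet ρ := by
  obtain ⟨g, s, rfl⟩ := hb
  exact ⟨w * g, s, (rep_mul_apply _ _ _).symm⟩

lemma IsReflIn.unique [Fintype S] (hf : Function.Injective ρ) {t t' : W} {b : S → ℝ}
    (ht : IsReflIn M ρ t b) (ht' : IsReflIn M ρ t' b) : t = t' :=
  hf (LinearEquiv.ext fun v => (ht v).trans (ht' v).symm)

lemma IsReflIn.neg [Fintype S] {t : W} {b : S → ℝ} (ht : IsReflIn M ρ t b) :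
    IsReflIn M ρ t (-b) := by
  intro v
  rw [ht, bform_neg_left]
  module

end Roots

section Reflections

variable {S : Type*} [Fintype S] [DecidableEq S] {M : CoxeterMatrix S} {W : Type*} [Group W]
  {cs : CoxeterSystem M W} {ρ : W →* ((S → ℝ) ≃ₗ[ℝ] (S → ℝ))}

lemma mem_posRoots {b : S → ℝ} : b ∈ posRoots ρ ↔ 0 ≤ b ∧ b ∈ rootSet ρ :=
  and_congr_left fun _ => mem_coneOf_range_simpleRoot

lemma bform_rep (hρ : IsGeometricRep cs ρ) (w : W) :
    ∀ x y : S → ℝ, bform M (ρ w x) (ρ w y) = bform M x y := by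
  induction w using cs.simple_induction_left with
  | one => simp
  | mul_simple_left w i ih =>
    intro x y
    rw [rep_mul_apply, rep_mul_apply, ← ih x y]
    simp only [hρ i, bform_sub_left, bform_sub_right, bform_smul_left, bform_smul_right,
      bform_simpleRoot_self, bform_comm _ (simpleRoot i)]
    ring

lemma bform_root_self (hρ : IsGeometricRep cs ρ) {b : S → ℝ} (hb : b ∈ rootSet ρ) :
    bform M b b = 1 := by
  obtain ⟨w, s, rfl⟩ := hb
  rw [bform_rep hρ, bform_simpleRoot_self]

lemma neg_mem_rootSet (hρ : IsGeometricRep cs ρ) {b : S → ℝ} (hb : b ∈ rootSet ρ) :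
    -b ∈ rootSet ρ := by
  obtain ⟨g, s, rfl⟩ := hb
  exact ⟨g * cs.simple s, s, by rw [rep_mul_apply, rep_simple_self hρ, map_neg]⟩

lemma root_ne_zero (hρ : IsGeometricRep cs ρ) {b : S → ℝ} (hb : b ∈ rootSet ρ) : b ≠ 0 := by
  rintro rfl
  have h := bform_root_self hρ hb
  rw [← zero_smul ℝ (0 : S → ℝ), bform_smul_left] at h
  simp at h

lemma root_not_nonpos (hρ : IsGeometricRep cs ρ) {b : S → ℝ} (hb : b ∈ rootSet ρ) (h : 0 ≤ b) :
    ¬ b ≤ 0 := fun h' => root_ne_zero hρ hb (le_antisymm h' h)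

lemma root_nonpos_of_not_nonneg (hρ : IsGeometricRep cs ρ) {b : S → ℝ} (hb : b ∈ rootSet ρ)
    (h : ¬ 0 ≤ b) : b ≤ 0 := (root_nonneg_or_nonpos hρ hb).resolve_left h

lemma root_nonneg_of_not_nonpos (hρ : IsGeometricRep cs ρ) {b : S → ℝ} (hb : b ∈ rootSet ρ)
    (h : ¬ b ≤ 0) : 0 ≤ b := (root_nonneg_or_nonpos hρ hb).resolve_right h

lemma posRoot_eq_of_eq_smul (hρ : IsGeometricRep cs ρ) {b c : S → ℝ} (hb : b ∈ posRoots ρ)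
    (hc : c ∈ posRoots ρ) {k : ℝ} (h : b = k • c) : b = c := by
  rw [mem_posRoots] at hb hc
  have h1 := bform_root_self hρ hb.2
  rw [h, bform_smul_left, bform_smul_right, bform_root_self hρ hc.2, mul_one] at h1
  rcases mul_self_eq_one_iff.mp h1 with rfl | rfl
  · simpa using h
  · refine absurd ?_ (root_not_nonpos hρ hb.2 hb.1)
    rw [h, neg_one_smul]
    exact neg_nonpos.mpr hc.1

lemma exists_apply_pos_of_ne (hρ : IsGeometricRep cs ρ) {s : S} {b : S → ℝ} (hb : b ∈ posRoots ρ)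
    (hne : b ≠ simpleRoot s) : ∃ i, i ≠ s ∧ 0 < b i := by
  by_contra! hcon
  refine hne (posRoot_eq_of_eq_smul hρ hb
    (mem_posRoots.mpr ⟨simpleRoot_nonneg s, simpleRoot_mem_rootSet s⟩)
    (eq_smul_simpleRoot fun i hi => le_antisymm (hcon i hi) ((mem_posRoots.mp hb).1 i)))

lemma rep_simple_nonneg (hρ : IsGeometricRep cs ρ) {s : S} {b : S → ℝ} (hb : b ∈ posRoots ρ)
    (hne : b ≠ simpleRoot s) : 0 ≤ ρ (cs.simple s) b := by
  obtain ⟨i, his, hi⟩ := exists_apply_pos_of_ne hρ hb hne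
  refine root_nonneg_of_not_nonpos hρ (rep_mem_rootSet _ (mem_posRoots.mp hb).2) fun h => ?_
  have := h i
  rw [hρ] at this
  simp [simpleRoot, his] at this
  linarith

lemma IsReflIn.apply_self (hρ : IsGeometricRep cs ρ) {t : W} {b : S → ℝ}
    (hb : b ∈ rootSet ρ) (ht : IsReflIn M ρ t b) : ρ t b = -b := by
  rw [ht, bform_root_self hρ hb]
  module

lemma IsReflIn.apply_apply (hρ : IsGeometricRep cs ρ) {t : W} {b : S → ℝ}
    (hb : b ∈ rootSet ρ) (ht : IsReflIn M ρ t b) (v : S → ℝ) : ρ t (ρ t v) = v := by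
  rw [ht v, map_sub, map_smul, ht.apply_self hρ hb, ht v]
  module

lemma IsReflIn.mul_self (hρ : IsGeometricRep cs ρ) (hf : Function.Injective ρ) {t : W}
    {b : S → ℝ} (hb : b ∈ rootSet ρ) (ht : IsReflIn M ρ t b) : t * t = 1 := by
  refine hf (LinearEquiv.ext fun v => ?_)
  rw [rep_mul_apply, ht.apply_apply hρ hb, map_one]
  rfl

lemma IsReflIn.inv_eq (hρ : IsGeometricRep cs ρ) (hf : Function.Injective ρ) {t : W}
    {b : S → ℝ} (hb : b ∈ rootSet ρ) (ht : IsReflIn M ρ t b) : t⁻¹ = t :=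
  inv_eq_of_mul_eq_one_left (ht.mul_self hρ hf hb)

lemma IsReflIn.conj (hρ : IsGeometricRep cs ρ) {t : W} {b : S → ℝ} (ht : IsReflIn M ρ t b)
    (g : W) : IsReflIn M ρ (g * t * g⁻¹) (ρ g b) := by
  intro v
  have h := bform_rep hρ g b (ρ g⁻¹ v)
  rw [rep_apply_inv_self] at h
  rw [rep_mul_apply, rep_mul_apply, ht, map_sub, map_smul, rep_apply_inv_self, h]

lemma isReflIn_simple (hρ : IsGeometricRep cs ρ) (s : S) :
    IsReflIn M ρ (cs.simple s) (simpleRoot s) := hρ s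

lemma IsReflIn.isReflection (hρ : IsGeometricRep cs ρ) (hf : Function.Injective ρ) {t : W}
    {b : S → ℝ} (hb : b ∈ rootSet ρ) (ht : IsReflIn M ρ t b) : cs.IsReflection t := by
  obtain ⟨g, s, rfl⟩ := hb
  exact ⟨g, s, ht.unique hf ((isReflIn_simple hρ s).conj hρ g)⟩

lemma length_mul_wordProd_lt (hρ : IsGeometricRep cs ρ) (hf : Function.Injective ρ)
    (ω : List S) : ∀ {t : W} {b : S → ℝ}, b ∈ posRoots ρ → IsReflIn M ρ t b →
      ρ (cs.wordProd ω)⁻¹ b ≤ 0 → cs.length (t * cs.wordProd ω) < ω.length := by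
  induction ω with
  | nil =>
    intro t b hb ht h
    refine absurd ?_ (root_not_nonpos hρ (mem_posRoots.mp hb).2 (mem_posRoots.mp hb).1)
    simpa using h
  | cons i ω ih =>
    intro t b hb ht h
    rw [CoxeterSystem.wordProd_cons] at h ⊢
    by_cases hbi : b = simpleRoot i
    · subst hbi
      rw [ht.unique hf (isReflIn_simple hρ i), CoxeterSystem.simple_mul_simple_cancel_left]
      simpa [Nat.lt_succ_iff] using cs.length_wordProd_le ω
    · have hb' : ρ (cs.simple i) b ∈ posRoots ρ := mem_posRoots.mpr
        ⟨rep_simple_nonneg hρ hb hbi, rep_mem_rootSet _ (mem_posRoots.mp hb).2⟩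
      rw [mul_inv_rev, rep_mul_apply, CoxeterSystem.inv_simple] at h
      have h1 := ih hb' (ht.conj hρ (cs.simple i)) h
      have h2 : t * (cs.simple i * cs.wordProd ω) =
          cs.simple i * (cs.simple i * t * (cs.simple i)⁻¹ * cs.wordProd ω) := by
        simp [mul_assoc]
      rw [h2, List.length_cons]
      refine lt_of_le_of_lt (cs.length_mul_le _ _) ?_
      rw [cs.length_simple]
      omega

lemma length_reflection_mul_lt_iff (hρ : IsGeometricRep cs ρ) (hf : Function.Injective ρ)
    {t w : W} {b : S → ℝ} (hb : b ∈ posRoots ρ) (ht : IsReflIn M ρ t b) :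
    cs.length (t * w) < cs.length w ↔ ρ w⁻¹ b ≤ 0 := by
  have key (w : W) (h : ρ w⁻¹ b ≤ 0) : cs.length (t * w) < cs.length w := by
    obtain ⟨ω, hω, rfl⟩ := cs.exists_isReduced w
    rw [hω.eq]
    exact length_mul_wordProd_lt hρ hf ω hb ht h
  refine ⟨fun h => ?_, key w⟩
  have hb' := (mem_posRoots.mp hb).2
  refine root_nonpos_of_not_nonneg hρ (rep_mem_rootSet _ hb') fun h0 => ?_
  have := key (t * w) (by
    rw [mul_inv_rev, ht.inv_eq hρ hf hb', rep_mul_apply, ht.apply_self hρ hb', map_neg]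
    exact neg_nonpos.mpr h0)
  rw [← mul_assoc, ht.mul_self hρ hf hb', one_mul] at this
  omega

lemma mem_invSet {w : W} {b : S → ℝ} (hρ : IsGeometricRep cs ρ) :
    b ∈ invSet ρ w ↔ b ∈ posRoots ρ ∧ ρ w⁻¹ b ≤ 0 := by
  refine and_congr_right fun hb => ?_
  change -ρ w⁻¹ b ∈ posRoots ρ ↔ _
  rw [mem_posRoots, neg_nonneg]
  exact and_iff_left (neg_mem_rootSet hρ (rep_mem_rootSet _ (mem_posRoots.mp hb).2))

end Reflections

section InversionSets

variable {S : Type*} [Fintype S] [DecidableEq S] {M : CoxeterMatrix S} {W : Type*} [Group W]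
  {cs : CoxeterSystem M W} {ρ : W →* ((S → ℝ) ≃ₗ[ℝ] (S → ℝ))}

lemma mem_invSet_reflection_mul (hρ : IsGeometricRep cs ρ) (hf : Function.Injective ρ)
    {t v : W} {c : S → ℝ} (hc : c ∈ posRoots ρ) (ht : IsReflIn M ρ t c) (hv : ¬ ρ v⁻¹ c ≤ 0) :
    c ∈ invSet ρ (t * v) := by
  have hcr := (mem_posRoots.mp hc).2
  refine (mem_invSet hρ).mpr ⟨hc, ?_⟩
  rw [mul_inv_rev, ht.inv_eq hρ hf hcr, rep_mul_apply, ht.apply_self hρ hcr, map_neg]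
  exact neg_nonpos.mpr (root_nonneg_of_not_nonpos hρ (rep_mem_rootSet _ hcr) hv)

/-- Left multiplication by a reflection that is simple relative to the subspace `P` adds one
inversion inside `P`. -/
lemma encard_invSet_inter_reflection_mul (hρ : IsGeometricRep cs ρ) (hf : Function.Injective ρ)
    {P : Submodule ℝ (S → ℝ)} {t v : W} {c : S → ℝ} (hc : c ∈ posRoots ρ) (hcP : c ∈ P)
    (ht : IsReflIn M ρ t c)
    (hperm : ∀ e ∈ posRoots ρ, e ∈ P → e ≠ c → 0 ≤ ρ t e) (hv : ¬ ρ v⁻¹ c ≤ 0) :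
    (invSet ρ (t * v) ∩ P).encard = (invSet ρ v ∩ P).encard + 1 := by
  have hcr := (mem_posRoots.mp hc).2
  have htP {e : S → ℝ} (he : e ∈ P) : ρ t e ∈ P := by
    rw [ht]
    exact P.sub_mem he (P.smul_mem _ hcP)
  have hset : invSet ρ (t * v) ∩ P = insert c (ρ t '' (invSet ρ v ∩ P)) := by
    ext e
    simp only [Set.mem_inter_iff, mem_invSet hρ, Set.mem_insert_iff, Set.mem_image, mul_inv_rev,
      ht.inv_eq hρ hf hcr, rep_mul_apply, SetLike.mem_coe]
    constructor
    · rintro ⟨⟨he, hev⟩, heP⟩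
      by_cases hec : e = c
      · exact Or.inl hec
      · exact Or.inr ⟨ρ t e, ⟨⟨mem_posRoots.mpr ⟨hperm e he heP hec,
          rep_mem_rootSet _ (mem_posRoots.mp he).2⟩, hev⟩, htP heP⟩, ht.apply_apply hρ hcr e⟩
    · rintro (rfl | ⟨d, ⟨⟨hd, hdv⟩, hdP⟩, rfl⟩)
      · refine ⟨⟨hc, ?_⟩, hcP⟩
        rw [ht.apply_self hρ hcr, map_neg]
        exact neg_nonpos.mpr (root_nonneg_of_not_nonpos hρ (rep_mem_rootSet _ hcr) hv)
      · refine ⟨⟨mem_posRoots.mpr ⟨hperm d hd hdP ?_,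
          rep_mem_rootSet _ (mem_posRoots.mp hd).2⟩, ?_⟩, htP hdP⟩
        · rintro rfl
          exact hv hdv
        · rwa [ht.apply_apply hρ hcr]
  rw [hset, Set.encard_insert_of_notMem, (ρ t).injective.encard_image]
  rintro ⟨d, ⟨hd, -⟩, hdc⟩
  have hd0 := (mem_posRoots.mp ((mem_invSet hρ).mp hd).1).1
  have : d = -c := by rw [← ht.apply_self hρ hcr, ← hdc, ht.apply_apply hρ hcr]
  rw [this] at hd0
  exact root_not_nonpos hρ hcr (mem_posRoots.mp hc).1 (neg_nonneg.mp hd0)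

lemma simpleRoot_mem_posRoots (s : S) : simpleRoot s ∈ posRoots ρ :=
  mem_posRoots.mpr ⟨simpleRoot_nonneg s, simpleRoot_mem_rootSet s⟩

lemma encard_invSet (hρ : IsGeometricRep cs ρ) (hf : Function.Injective ρ) :
    ∀ (n : ℕ) (w : W), cs.length w = n → (invSet ρ w).encard = n := by
  intro n
  induction n with
  | zero =>
    intro w hw
    rw [cs.length_eq_zero_iff] at hw
    subst hw
    rw [Nat.cast_zero, Set.encard_eq_zero, Set.eq_empty_iff_forall_notMem]
    intro b hb
    rw [mem_invSet hρ, mem_posRoots] at hb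
    exact root_not_nonpos hρ hb.1.2 hb.1.1 (by simpa using hb.2)
  | succ n ih =>
    intro w hw
    have hne : w ≠ 1 := by
      rintro rfl
      simp at hw
    obtain ⟨i, hi⟩ := cs.exists_leftDescent_of_ne_one hne
    rw [CoxeterSystem.isLeftDescent_iff] at hi
    have hi' : ¬ ρ (cs.simple i * w)⁻¹ (simpleRoot i) ≤ 0 := by
      rw [← length_reflection_mul_lt_iff hρ hf (simpleRoot_mem_posRoots i) (isReflIn_simple hρ i),
        CoxeterSystem.simple_mul_simple_cancel_left]
      omega
    have := encard_invSet_inter_reflection_mul hρ hf (P := ⊤) (simpleRoot_mem_posRoots i)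
      (Submodule.mem_top) (isReflIn_simple hρ i) (fun e he _ hne => rep_simple_nonneg hρ he hne) hi'
    rw [CoxeterSystem.simple_mul_simple_cancel_left] at this
    simp only [Submodule.top_coe, Set.inter_univ] at this
    rw [this, ih _ (by omega)]
    norm_cast

lemma finite_invSet (hρ : IsGeometricRep cs ρ) (hf : Function.Injective ρ) (w : W) :
    (invSet ρ w).Finite :=
  Set.finite_of_encard_eq_coe (encard_invSet hρ hf _ w rfl)

/-- For `ℓ(v) < ℓ(t v)`, the standard injection of the inversion set of `v` into that of `t v`. -/
noncomputable def invSetMap (ρ : W →* ((S → ℝ) ≃ₗ[ℝ] (S → ℝ))) (t : W) (d : S → ℝ) : S → ℝ :=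
  open Classical in if 0 ≤ ρ t d then ρ t d else d

lemma invSetMap_mem (hρ : IsGeometricRep cs ρ) (hf : Function.Injective ρ)
    {t v : W} {c d : S → ℝ} (hc : c ∈ posRoots ρ) (ht : IsReflIn M ρ t c)
    (hv : ¬ ρ v⁻¹ c ≤ 0) (hd : d ∈ invSet ρ v) :
    invSetMap ρ t d ∈ invSet ρ (t * v) \ {c} := by
  have hcr := (mem_posRoots.mp hc).2
  have hv0 := root_nonneg_of_not_nonpos hρ (rep_mem_rootSet v⁻¹ hcr) hv
  rw [mem_invSet hρ] at hd
  obtain ⟨hdp, hdv⟩ := hd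
  obtain ⟨hd0, hdr⟩ := mem_posRoots.mp hdp
  simp only [Set.mem_sdiff, mem_invSet hρ, Set.mem_singleton_iff, mul_inv_rev,
      ht.inv_eq hρ hf hcr, rep_mul_apply]
  unfold invSetMap
  split_ifs with h
  · refine ⟨⟨mem_posRoots.mpr ⟨h, rep_mem_rootSet _ hdr⟩, ?_⟩, fun hdc => ?_⟩
    · rwa [ht.apply_apply hρ hcr]
    · have : d = -c := by rw [← ht.apply_self hρ hcr, ← hdc, ht.apply_apply hρ hcr]
      rw [this] at hd0
      exact root_not_nonpos hρ hcr (mem_posRoots.mp hc).1 (neg_nonneg.mp hd0)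
  · refine ⟨⟨hdp, ?_⟩, ?_⟩
    · have hB : 0 ≤ bform M c d := by
        by_contra! hB
        refine h ?_
        rw [ht, sub_eq_add_neg, ← neg_smul]
        exact add_nonneg hd0 (smul_nonneg (by linarith) (mem_posRoots.mp hc).1)
      rw [ht, map_sub, map_smul, sub_nonpos]
      exact hdv.trans (smul_nonneg (by linarith) hv0)
    · rintro rfl
      exact hv hdv

lemma invSetMap_injOn (hρ : IsGeometricRep cs ρ) {t v : W} {c : S → ℝ} (hc : c ∈ posRoots ρ)
    (ht : IsReflIn M ρ t c) : Set.InjOn (invSetMap ρ t) (invSet ρ v) := by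
  have hcr := (mem_posRoots.mp hc).2
  intro d hd e he h
  have hd0 := (mem_posRoots.mp ((mem_invSet hρ).mp hd).1).1
  have he0 := (mem_posRoots.mp ((mem_invSet hρ).mp he).1).1
  unfold invSetMap at h
  split_ifs at h with h1 h2 h2
  · exact (ρ t).injective h
  · exact absurd (by rwa [← h, ht.apply_apply hρ hcr]) h2
  · exact absurd (by rwa [h, ht.apply_apply hρ hcr]) h1
  · exact h

lemma encard_invSet_inter_lt (hρ : IsGeometricRep cs ρ) (hf : Function.Injective ρ)
    {P : Submodule ℝ (S → ℝ)} {t v : W} {c : S → ℝ} (hc : c ∈ posRoots ρ) (hcP : c ∈ P)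
    (ht : IsReflIn M ρ t c) (hv : ¬ ρ v⁻¹ c ≤ 0) :
    (invSet ρ v ∩ P).encard + 1 ≤ (invSet ρ (t * v) ∩ P).encard := by
  have hmem : c ∈ invSet ρ (t * v) ∩ P :=
    ⟨mem_invSet_reflection_mul hρ hf hc ht hv, hcP⟩
  rw [← Set.encard_sdiff_singleton_add_one hmem]
  rw [ENat.add_le_add_iff_right ENat.one_ne_top,
    ← ((invSetMap_injOn hρ hc ht).mono Set.inter_subset_left).encard_image]
  refine Set.encard_le_encard ?_
  rintro _ ⟨d, ⟨hd, hdP⟩, rfl⟩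
  obtain ⟨h1, h2⟩ := invSetMap_mem hρ hf hc ht hv hd
  refine ⟨⟨h1, ?_⟩, h2⟩
  unfold invSetMap
  split_ifs
  · rw [ht]
    exact P.sub_mem hdP (P.smul_mem _ hcP)
  · exact hdP

/-- If `t v` covers `v` in Bruhat order, then new inversions of `t v` other than the root of `t`
are sent to positive roots by `t`. -/
lemma rep_nonneg_of_cover (hρ : IsGeometricRep cs ρ) (hf : Function.Injective ρ)
    {t v : W} {c b : S → ℝ} (hc : c ∈ posRoots ρ) (ht : IsReflIn M ρ t c)
    (hlen : cs.length (t * v) = cs.length v + 1) (hb : b ∈ invSet ρ (t * v)) (hbc : b ≠ c)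
    (hbv : b ∉ invSet ρ v) : 0 ≤ ρ t b := by
  have hcr := (mem_posRoots.mp hc).2
  have hv : ¬ ρ v⁻¹ c ≤ 0 := by
    rw [← length_reflection_mul_lt_iff hρ hf hc ht]
    omega
  have hmem : c ∈ invSet ρ (t * v) :=
    mem_invSet_reflection_mul hρ hf hc ht hv
  have himg : invSetMap ρ t '' invSet ρ v = invSet ρ (t * v) \ {c} := by
    refine ((finite_invSet hρ hf v).image _).eq_of_subset_of_encard_le ?_ ?_
    · rintro _ ⟨d, hd, rfl⟩
      exact invSetMap_mem hρ hf hc ht hv hd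
    · rw [(invSetMap_injOn hρ hc ht).encard_image, encard_invSet hρ hf _ v rfl,
        ← ENat.add_le_add_iff_right ENat.one_ne_top, Set.encard_sdiff_singleton_add_one hmem,
        encard_invSet hρ hf _ _ hlen]
      norm_cast
  obtain ⟨d, hd, hdb⟩ : b ∈ invSetMap ρ t '' invSet ρ v := himg ▸ ⟨hb, hbc⟩
  unfold invSetMap at hdb
  split_ifs at hdb with h
  · rw [← hdb, ht.apply_apply hρ hcr]
    exact (mem_posRoots.mp ((mem_invSet hρ).mp hd).1).1
  · exact absurd (hdb ▸ hd) hbv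

end InversionSets

section DihedralSubgroup

lemma exists_zpow_of_mem_closure_pair {G : Type*} [Group G] {a b g : G} (ha : a * a = 1)
    (hb : b * b = 1) (hg : g ∈ Subgroup.closure {a, b}) :
    ∃ k : ℤ, g = (a * b) ^ k ∨ g = (a * b) ^ k * a := by
  have ha' : a⁻¹ = a := inv_eq_of_mul_eq_one_left ha
  have hb' : b⁻¹ = b := inv_eq_of_mul_eq_one_left hb
  have hconj (k : ℤ) : a * (a * b) ^ k = (a * b) ^ (-k) * a := by
    have h : a * (a * b) * a⁻¹ = (a * b)⁻¹ := by
      rw [mul_inv_rev, ha', hb', ← mul_assoc, ha, one_mul]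
    have h2 : a * (a * b) ^ k * a⁻¹ = (a * b) ^ (-k) := by
      rw [← conj_zpow, h, inv_zpow, zpow_neg]
    rw [← h2, inv_mul_cancel_right]
  have hstep {x y : G} (hx : x = a ∨ x = b)
      (hy : ∃ k : ℤ, y = (a * b) ^ k ∨ y = (a * b) ^ k * a) :
      ∃ k : ℤ, x * y = (a * b) ^ k ∨ x * y = (a * b) ^ k * a := by
    have hb2 (k : ℤ) : b * (a * b) ^ k = (a * b) ^ (-(k + 1)) * a := by
      rw [← hconj, add_comm, zpow_one_add, ← mul_assoc, ← mul_assoc, ha, one_mul]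
    obtain ⟨k, rfl | rfl⟩ := hy <;> rcases hx with rfl | rfl
    · exact ⟨-k, Or.inr (hconj k)⟩
    · exact ⟨_, Or.inr (hb2 k)⟩
    · exact ⟨-k, Or.inl (by rw [← mul_assoc, hconj, mul_assoc, ha, mul_one])⟩
    · exact ⟨_, Or.inl (by rw [← mul_assoc, hb2, mul_assoc, ha, mul_one])⟩
  induction hg using Subgroup.closure_induction_left with
  | one => exact ⟨0, Or.inl (by simp)⟩
  | mul_left x hx y _ hy => exact hstep hx hy
  | inv_mul_cancel x hx y _ hy =>
    refine hstep ?_ hy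
    rcases hx with rfl | hx
    · exact Or.inl ha'
    · rw [Set.mem_singleton_iff] at hx
      exact Or.inr (hx ▸ hb')

variable {S : Type*} [Fintype S] [DecidableEq S] {M : CoxeterMatrix S} {W : Type*} [Group W]
  {cs : CoxeterSystem M W} {ρ : W →* ((S → ℝ) ≃ₗ[ℝ] (S → ℝ))}

lemma rep_mem_of_mem_closure_pair (hρ : IsGeometricRep cs ρ) (hf : Function.Injective ρ)
    {P : Submodule ℝ (S → ℝ)} {r t g : W} {a c e : S → ℝ}
    (ha : a ∈ rootSet ρ) (hc : c ∈ rootSet ρ) (haP : a ∈ P) (hcP : c ∈ P)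
    (hr : IsReflIn M ρ r a) (ht : IsReflIn M ρ t c) (hg : g ∈ Subgroup.closure {r, t})
    (he : e ∈ P) : ρ g e ∈ P := by
  have hstep {x : W} (hx : x = r ∨ x = t) {y : S → ℝ} (hy : y ∈ P) : ρ x y ∈ P := by
    rcases hx with rfl | rfl
    · rw [hr]
      exact P.sub_mem hy (P.smul_mem _ haP)
    · rw [ht]
      exact P.sub_mem hy (P.smul_mem _ hcP)
  induction hg using Subgroup.closure_induction_left with
  | one => simpa using he
  | mul_left x hx y _ hy =>
    rw [rep_mul_apply]
    exact hstep hx hy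
  | inv_mul_cancel x hx y _ hy =>
    rw [rep_mul_apply]
    refine hstep ?_ hy
    rcases hx with rfl | hx
    · exact Or.inl (hr.inv_eq hρ hf ha)
    · rw [Set.mem_singleton_iff] at hx
      rw [hx]
      exact Or.inr (ht.inv_eq hρ hf hc)

/-- Elements of odd length in the group generated by two reflections are reflections. -/
lemma exists_isReflIn_of_odd_length (hρ : IsGeometricRep cs ρ) (hf : Function.Injective ρ)
    {P : Submodule ℝ (S → ℝ)} {r t g : W} {a c : S → ℝ}
    (ha : a ∈ rootSet ρ) (hc : c ∈ rootSet ρ) (haP : a ∈ P) (hcP : c ∈ P)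
    (hr : IsReflIn M ρ r a) (ht : IsReflIn M ρ t c) (hg : g ∈ Subgroup.closure {r, t})
    (hodd : Odd (cs.length g)) :
    ∃ d ∈ posRoots ρ, d ∈ P ∧ IsReflIn M ρ g d := by
  have hr2 := hr.mul_self hρ hf ha
  have ht2 := ht.mul_self hρ hf hc
  have hrinv := hr.inv_eq hρ hf ha
  have htinv := ht.inv_eq hρ hf hc
  let R : W → Prop := fun x => ∃ d ∈ rootSet ρ, d ∈ P ∧ IsReflIn M ρ x d
  have hrD : r ∈ Subgroup.closure {r, t} := Subgroup.subset_closure (by simp)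
  have htD : t ∈ Subgroup.closure {r, t} := Subgroup.subset_closure (by simp)
  have hconj {x h : W} (hx : R x) (hh : h ∈ Subgroup.closure {r, t}) : R (h * x * h⁻¹) := by
    obtain ⟨d, hd, hdP, hxd⟩ := hx
    exact ⟨ρ h d, rep_mem_rootSet _ hd,
      rep_mem_of_mem_closure_pair hρ hf ha hc haP hcP hr ht hh hdP, hxd.conj hρ h⟩
  have hR (k : ℤ) : R ((r * t) ^ k * r) ∧ R ((r * t) ^ (k + 1) * r) := by
    have hRr : R r := ⟨a, ha, haP, hr⟩
    have hRt : R t := ⟨c, hc, hcP, ht⟩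
    induction k using Int.induction_on with
    | zero =>
      refine ⟨by simpa using hRr, ?_⟩
      have := hconj hRt hrD
      rw [hrinv] at this
      simpa using this
    | succ k ih =>
      refine ⟨ih.2, ?_⟩
      convert hconj ih.1 (mul_mem hrD htD) using 1
      have hswap : r * (r * t)⁻¹ = r * t * r := by rw [mul_inv_rev, hrinv, htinv, mul_assoc]
      rw [mul_assoc (r * t), mul_assoc (_ ^ _) r, hswap, ← mul_assoc (_ ^ _), ← zpow_add_one,
        ← mul_assoc, ← zpow_one_add, add_comm 1]
    | pred k ih =>
      refine ⟨?_, by simpa using ih.1⟩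
      convert hconj ih.2 (inv_mem (mul_mem hrD htD)) using 1
      have hswap : r * (r * t) = (r * t)⁻¹ * r := by
        rw [mul_inv_rev, hrinv, htinv, ← mul_assoc, hr2, one_mul, mul_assoc, hr2, mul_one]
      rw [inv_inv, mul_assoc, mul_assoc, hswap, ← mul_assoc (_ ^ _), ← mul_assoc, ← zpow_sub_one,
        ← zpow_neg_one, ← zpow_add]
      congr 2
      ring
  obtain ⟨k, hk | hk⟩ := exists_zpow_of_mem_closure_pair hr2 ht2 hg
  · exfalso
    have hpar {x : W} {d : S → ℝ} (hd : d ∈ rootSet ρ) (hx : IsReflIn M ρ x d) :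
        cs.lengthParity x = Multiplicative.ofAdd 1 := by
      rw [cs.lengthParity_eq_ofAdd_length,
        ZMod.natCast_eq_one_iff_odd.mpr (hx.isReflection hρ hf hd).odd_length]
    have hone : cs.lengthParity (r * t) = 1 := by
      rw [map_mul, hpar ha hr, hpar hc ht]
      rfl
    have h1 := cs.lengthParity_eq_ofAdd_length g
    rw [hk, map_zpow, hone, one_zpow, ← hk, ZMod.natCast_eq_one_iff_odd.mpr hodd] at h1
    exact absurd h1 (by decide)
  · obtain ⟨d, hd, hdP, hgd⟩ := (hR k).1
    rw [← hk] at hgd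
    rcases root_nonneg_or_nonpos hρ hd with h | h
    · exact ⟨d, mem_posRoots.mpr ⟨h, hd⟩, hdP, hgd⟩
    · exact ⟨-d, mem_posRoots.mpr ⟨neg_nonneg.mpr h, neg_mem_rootSet hρ hd⟩, P.neg_mem hdP,
        hgd.neg⟩

end DihedralSubgroup

section Covers

variable {S : Type*} [Fintype S] [DecidableEq S] {M : CoxeterMatrix S} {W : Type*} [Group W]
  {cs : CoxeterSystem M W} {ρ : W →* ((S → ℝ) ≃ₗ[ℝ] (S → ℝ))}

lemma eq_zero_of_smul_simpleRoot_add_smul_eq_zero (hρ : IsGeometricRep cs ρ) {s : S}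
    {c : S → ℝ} (hc : c ∈ posRoots ρ) (hcs : c ≠ simpleRoot s) {x y : ℝ}
    (h : x • simpleRoot s + y • c = 0) : x = 0 ∧ y = 0 := by
  obtain ⟨i, his, hi⟩ := exists_apply_pos_of_ne hρ hc hcs
  have hy : y = 0 := by
    have := congrFun h i
    simpa [simpleRoot, his, hi.ne'] using this
  refine ⟨?_, hy⟩
  have := congrFun h s
  simpa [simpleRoot, hy] using this

/-- If `t v` covers `v` and the simple root `α_s` is an inversion of `v` but not of `t v`, then
`α_s` and the root of `t` are the canonical basis of the rank two subsystem they generate. -/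
lemma exists_nonneg_combination_of_cover (hρ : IsGeometricRep cs ρ) (hf : Function.Injective ρ)
    {s : S} {t v : W} {c : S → ℝ} (hc : c ∈ posRoots ρ) (hcs : c ≠ simpleRoot s)
    (ht : IsReflIn M ρ t c) (hlen : cs.length (t * v) = cs.length v + 1)
    (hsv : ρ v⁻¹ (simpleRoot s) ≤ 0) (hsu : ¬ ρ (t * v)⁻¹ (simpleRoot s) ≤ 0) {e : S → ℝ}
    (he : e ∈ posRoots ρ) (heP : e ∈ Submodule.span ℝ {simpleRoot s, c}) :
    ∃ p q : ℝ, 0 ≤ p ∧ 0 ≤ q ∧ e = p • simpleRoot s + q • c := by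
  obtain ⟨hc0, hcr⟩ := mem_posRoots.mp hc
  obtain ⟨he0, her⟩ := mem_posRoots.mp he
  obtain ⟨p, q, hpq⟩ := Submodule.mem_span_pair.mp heP
  obtain ⟨i, his, hi⟩ := exists_apply_pos_of_ne hρ hc hcs
  have hq : 0 ≤ q := by
    have h := he0 i
    rw [← hpq] at h
    simp only [Pi.zero_apply, Pi.add_apply, Pi.smul_apply, simpleRoot, Pi.single_eq_of_ne his,
      smul_eq_mul, mul_zero, zero_add] at h
    exact nonneg_of_mul_nonneg_left h hi
  refine ⟨p, q, ?_, hq, hpq.symm⟩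
  by_contra! hp
  have hv : ¬ ρ v⁻¹ c ≤ 0 := by
    rw [← length_reflection_mul_lt_iff hρ hf hc ht]
    omega
  have hv0 := root_nonneg_of_not_nonpos hρ (rep_mem_rootSet v⁻¹ hcr) hv
  have hsu0 := root_nonneg_of_not_nonpos hρ (rep_mem_rootSet _ (simpleRoot_mem_rootSet s)) hsu
  have hcu := ((mem_invSet hρ).mp (mem_invSet_reflection_mul hρ hf hc ht hv)).2
  have heu : e ∈ invSet ρ (t * v) := by
    refine (mem_invSet hρ).mpr ⟨he, ?_⟩
    rw [← hpq, map_add, map_smul, map_smul]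
    exact add_nonpos (smul_nonpos_of_nonpos_of_nonneg hp.le hsu0)
      (smul_nonpos_of_nonneg_of_nonpos hq hcu)
  have hev : e ∉ invSet ρ v := by
    intro h
    refine root_not_nonpos hρ (rep_mem_rootSet v⁻¹ her) ?_ ((mem_invSet hρ).mp h).2
    rw [← hpq, map_add, map_smul, map_smul]
    exact add_nonneg (smul_nonneg_of_nonpos_of_nonpos hp.le hsv) (smul_nonneg hq hv0)
  have hec : e ≠ c := by
    rintro rfl
    have h : p • simpleRoot s + (q - 1) • e = 0 := by
      rw [sub_smul, one_smul, ← add_sub_assoc, hpq, sub_self]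
    exact hp.ne (eq_zero_of_smul_simpleRoot_add_smul_eq_zero hρ hc hcs h).1
  have hte := rep_nonneg_of_cover hρ hf hc ht hlen heu hec hev
  have hts : 0 ≤ ρ t (simpleRoot s) := by
    by_contra h
    have h1 := (invSetMap_mem hρ hf hc ht hv
      ((mem_invSet hρ).mpr ⟨simpleRoot_mem_posRoots s, hsv⟩)).1
    rw [invSetMap, if_neg h, mem_invSet hρ] at h1
    exact hsu h1.2
  have hneg : ρ t e = p • ρ t (simpleRoot s) - q • c := by
    rw [← hpq, map_add, map_smul, map_smul, ht.apply_self hρ hcr, smul_neg, sub_eq_add_neg]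
  refine root_not_nonpos hρ (rep_mem_rootSet t her) hte ?_
  rw [hneg, sub_nonpos]
  exact (smul_nonpos_of_nonpos_of_nonneg hp.le hts).trans (smul_nonneg hq hc0)

lemma rep_reflection_nonneg_of_canonical (hρ : IsGeometricRep cs ρ) {s : S} {t : W} {c : S → ℝ}
    (hc : c ∈ posRoots ρ) (hcs : c ≠ simpleRoot s) (ht : IsReflIn M ρ t c)
    (hcan : ∀ e ∈ posRoots ρ, e ∈ Submodule.span ℝ {simpleRoot s, c} →
      ∃ p q : ℝ, 0 ≤ p ∧ 0 ≤ q ∧ e = p • simpleRoot s + q • c)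
    {e : S → ℝ} (he : e ∈ posRoots ρ) (heP : e ∈ Submodule.span ℝ {simpleRoot s, c})
    (hec : e ≠ c) : 0 ≤ ρ t e := by
  have her := (mem_posRoots.mp he).2
  refine root_nonneg_of_not_nonpos hρ (rep_mem_rootSet _ her) fun h => ?_
  obtain ⟨p, q, hp, hq, hpq⟩ := hcan e he heP
  obtain ⟨p', q', hp', hq', hpq'⟩ := hcan (-ρ t e)
    (mem_posRoots.mpr ⟨neg_nonneg.mpr h, neg_mem_rootSet hρ (rep_mem_rootSet _ her)⟩)
    (Submodule.neg_mem _ (by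
      rw [ht]
      exact Submodule.sub_mem _ heP
        (Submodule.smul_mem _ _ (Submodule.subset_span (by simp)))))
  have h0 : (p + p') • simpleRoot s + (q + q' - 2 * bform M c e) • c = 0 := by
    have h1 : (p + p') • simpleRoot s + (q + q' - 2 * bform M c e) • c =
        (p • simpleRoot s + q • c) + (p' • simpleRoot s + q' • c) - (2 * bform M c e) • c := by
      module
    rw [h1, ← hpq, ← hpq', ht]
    module
  have hp0 : p = 0 := by
    linarith [(eq_zero_of_smul_simpleRoot_add_smul_eq_zero hρ hc hcs h0).1]
  exact hec (posRoot_eq_of_eq_smul hρ he hc (k := q) (by rw [hpq, hp0, zero_smul, zero_add]))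

lemma exists_minimal_coset_representative (hρ : IsGeometricRep cs ρ) (hf : Function.Injective ρ)
    {r t : W} {a c : S → ℝ} (ha : a ∈ posRoots ρ) (hc : c ∈ posRoots ρ) (hr : IsReflIn M ρ r a)
    (ht : IsReflIn M ρ t c) (w : W) :
    ∃ g ∈ Subgroup.closure {r, t}, 0 ≤ ρ (g⁻¹ * w)⁻¹ a ∧ 0 ≤ ρ (g⁻¹ * w)⁻¹ c := by
  let D := Subgroup.closure {r, t}
  obtain ⟨⟨g, hg⟩, hmin⟩ : ∃ g : D, ∀ h : D,
      cs.length ((g : W)⁻¹ * w) ≤ cs.length ((h : W)⁻¹ * w) :=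
    ⟨_, fun k => Function.argmin_le (fun h : D => cs.length ((h : W)⁻¹ * w)) k⟩
  have key {x : W} {d : S → ℝ} (hx : x ∈ D) (hd : d ∈ posRoots ρ) (hxd : IsReflIn M ρ x d) :
      0 ≤ ρ (g⁻¹ * w)⁻¹ d := by
    refine root_nonneg_of_not_nonpos hρ (rep_mem_rootSet _ (mem_posRoots.mp hd).2) fun h => ?_
    rw [← length_reflection_mul_lt_iff hρ hf hd hxd] at h
    have := hmin ⟨g * x⁻¹, mul_mem hg (inv_mem hx)⟩
    simp only [mul_inv_rev, inv_inv, mul_assoc] at this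
    omega
  exact ⟨g, hg, key (Subgroup.subset_closure (by simp)) ha hr,
    key (Subgroup.subset_closure (by simp)) hc ht⟩

/-- If `s t v` has length `ℓ(v) + 2` and `α_s`, `c` form the canonical basis of a rank two
subsystem, where `c` is the root of `t`, then `s t v` covers an element `s_b s t v` with
`b ≠ α_s` in that subsystem. -/
lemma exists_mem_nOne_of_canonical (hρ : IsGeometricRep cs ρ) (hf : Function.Injective ρ)
    {s : S} {t v : W} {c : S → ℝ} (hc : c ∈ posRoots ρ) (hcs : c ≠ simpleRoot s)
    (ht : IsReflIn M ρ t c) (hlen : cs.length (t * v) = cs.length v + 1)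
    (hlen2 : cs.length (cs.simple s * (t * v)) = cs.length v + 2)
    (hcan : ∀ e ∈ posRoots ρ, e ∈ Submodule.span ℝ {simpleRoot s, c} →
      ∃ p q : ℝ, 0 ≤ p ∧ 0 ≤ q ∧ e = p • simpleRoot s + q • c) :
    ∃ b ∈ nOne cs ρ (cs.simple s * (t * v)), b ≠ simpleRoot s ∧
      b ∈ Submodule.span ℝ {simpleRoot s, c} := by
  set P := Submodule.span ℝ {simpleRoot s, c}
  set D := Subgroup.closure {cs.simple s, t}
  set w := cs.simple s * (t * v) with hw
  have ha : simpleRoot s ∈ posRoots ρ := simpleRoot_mem_posRoots s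
  have har := simpleRoot_mem_rootSet (ρ := ρ) s
  have hcr := (mem_posRoots.mp hc).2
  have hs := isReflIn_simple hρ s
  have haP : simpleRoot s ∈ P := Submodule.subset_span (by simp)
  have hcP : c ∈ P := Submodule.subset_span (by simp)
  have hsD : cs.simple s ∈ D := Subgroup.subset_closure (by simp)
  have htD : t ∈ D := Subgroup.subset_closure (by simp)
  have hDP {h : W} (hh : h ∈ D) {e : S → ℝ} (he : e ∈ P) : ρ h e ∈ P :=
    rep_mem_of_mem_closure_pair hρ hf har hcr haP hcP hs ht hh he
  obtain ⟨g, hg, hxa, hxc⟩ := exists_minimal_coset_representative hρ hf ha hc hs ht w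
  set x := g⁻¹ * w with hx
  have hwx : w = g * x := by rw [hx, mul_inv_cancel_left]
  have hxpos {e : S → ℝ} (he : e ∈ posRoots ρ) (heP : e ∈ P) : 0 ≤ ρ x⁻¹ e := by
    obtain ⟨p, q, hp, hq, rfl⟩ := hcan e he heP
    rw [map_add, map_smul, map_smul]
    exact add_nonneg (smul_nonneg hp hxa) (smul_nonneg hq hxc)
  -- roots of `P` inverted by `(h x)⁻¹` are already inverted by `h⁻¹`
  have hinv {h : W} (hh : h ∈ D) {e : S → ℝ} (he : e ∈ posRoots ρ) (heP : e ∈ P)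
      (hle : ρ (h * x)⁻¹ e ≤ 0) : ρ h⁻¹ e ≤ 0 := by
    have her := (mem_posRoots.mp he).2
    refine root_nonpos_of_not_nonneg hρ (rep_mem_rootSet _ her) fun h0 => ?_
    rw [mul_inv_rev, rep_mul_apply] at hle
    exact root_not_nonpos hρ (rep_mem_rootSet _ (rep_mem_rootSet _ her))
      (hxpos (mem_posRoots.mpr ⟨h0, rep_mem_rootSet _ her⟩) (hDP (inv_mem hh) heP)) hle
  have hnot {h : W} (hh : h ∈ D) {e : S → ℝ} (he : e ∈ posRoots ρ) (heP : e ∈ P)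
      (hle : ρ (h * x)⁻¹ e ≤ 0) : ¬ (0 ≤ ρ h (simpleRoot s) ∧ 0 ≤ ρ h c) := by
    rintro ⟨h1, h2⟩
    obtain ⟨he0, her⟩ := mem_posRoots.mp he
    obtain ⟨p, q, hp, hq, hpq⟩ := hcan (-ρ h⁻¹ e) (mem_posRoots.mpr
      ⟨neg_nonneg.mpr (hinv hh he heP hle), neg_mem_rootSet hρ (rep_mem_rootSet _ her)⟩)
      (P.neg_mem (hDP (inv_mem hh) heP))
    have h3 := congrArg (ρ h) hpq
    rw [map_neg, rep_apply_inv_self, map_add, map_smul, map_smul] at h3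
    refine root_not_nonpos hρ her he0 (neg_nonneg.mp ?_)
    rw [h3]
    exact add_nonneg (smul_nonneg hp h1) (smul_nonneg hq h2)
  have hwa : ρ w⁻¹ (simpleRoot s) ≤ 0 := by
    rw [← length_reflection_mul_lt_iff hρ hf ha hs, hlen2, hw,
      CoxeterSystem.simple_mul_simple_cancel_left]
    omega
  have hua : ¬ ρ (t * v)⁻¹ (simpleRoot s) ≤ 0 := by
    rw [← length_reflection_mul_lt_iff hρ hf ha hs, ← hw]
    omega
  have hvc : ¬ ρ v⁻¹ c ≤ 0 := by
    rw [← length_reflection_mul_lt_iff hρ hf hc ht]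
    omega
  have huc : ρ (t * v)⁻¹ c ≤ 0 :=
    ((mem_invSet hρ).mp (mem_invSet_reflection_mul hρ hf hc ht hvc)).2
  have hpermC (e : S → ℝ) (he : e ∈ posRoots ρ) (heP : e ∈ P) (hec : e ≠ c) : 0 ≤ ρ t e :=
    rep_reflection_nonneg_of_canonical hρ hc hcs ht hcan he heP hec
  have hpermA (e : S → ℝ) (he : e ∈ posRoots ρ) (_ : e ∈ P) (hne : e ≠ simpleRoot s) :
      0 ≤ ρ (cs.simple s) e := rep_simple_nonneg hρ he hne
  have hsg : ∀ d ∈ rootSet ρ, 0 ≤ ρ g d → ρ g d ≠ simpleRoot s →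
      0 ≤ ρ (cs.simple s * g) d := fun d hd h0 hne => by
    rw [rep_mul_apply]
    exact rep_simple_nonneg hρ (mem_posRoots.mpr ⟨h0, rep_mem_rootSet _ hd⟩) hne
  have hsg' : ∀ d : S → ℝ, ρ g d = -simpleRoot s → 0 ≤ ρ (cs.simple s * g) d := fun d hd => by
    rw [rep_mul_apply, hd, map_neg, rep_simple_self hρ, neg_neg]
    exact simpleRoot_nonneg s
  have hne_neg {d d' : S → ℝ} (hd : ρ g d = -simpleRoot s) (hd0 : 0 ≤ d) (hd' : d' ∈ rootSet ρ)
      (hd0' : 0 ≤ d') : ρ g d' ≠ simpleRoot s := fun h => by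
    have : d = -d' := (ρ g).injective (by rw [hd, map_neg, h])
    refine root_not_nonpos hρ hd' hd0' (neg_nonneg.mp (this ▸ hd0))
  obtain ⟨d, y, hd, hdP, hy, hyD, hperm, hgd, hgne⟩ : ∃ (d : S → ℝ) (y : W), d ∈ posRoots ρ ∧
      d ∈ P ∧ IsReflIn M ρ y d ∧ y ∈ D ∧
      (∀ e ∈ posRoots ρ, e ∈ P → e ≠ d → 0 ≤ ρ y e) ∧ ρ g d ≤ 0 ∧ ρ g d ≠ -simpleRoot s := by
    by_contra! hcon
    have h1 := fun h => hcon _ _ ha haP hs hsD hpermA h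
    have h2 := fun h => hcon _ _ hc hcP ht htD hpermC h
    have hn := hnot hg ha haP (hwx ▸ hwa)
    have hn' := hnot (mul_mem hsD hg) hc hcP (by
      rwa [mul_assoc, ← hwx, hw, CoxeterSystem.simple_mul_simple_cancel_left])
    have ha0 := simpleRoot_nonneg s
    have hc0 := (mem_posRoots.mp hc).1
    rcases root_nonneg_or_nonpos hρ (rep_mem_rootSet g har) with h3 | h3 <;>
      rcases root_nonneg_or_nonpos hρ (rep_mem_rootSet g hcr) with h4 | h4
    · exact hn ⟨h3, h4⟩
    · exact hn' ⟨hsg _ har h3 (hne_neg (h2 h4) hc0 har ha0), hsg' _ (h2 h4)⟩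
    · exact hn' ⟨hsg' _ (h1 h3), hsg _ hcr h4 (hne_neg (h1 h3) ha0 hcr hc0)⟩
    · exact hcs ((ρ g).injective ((h2 h4).trans (h1 h3).symm))
  obtain ⟨hd0, hdr⟩ := mem_posRoots.mp hd
  set b := -ρ g d with hb
  have hbpos : b ∈ posRoots ρ :=
    mem_posRoots.mpr ⟨neg_nonneg.mpr hgd, neg_mem_rootSet hρ (rep_mem_rootSet _ hdr)⟩
  have hbP : b ∈ P := P.neg_mem (hDP hg hdP)
  have hbrefl : IsReflIn M ρ (g * y * g⁻¹) b := (hy.conj hρ g).neg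
  set z := g * y * g⁻¹ * w with hz
  have hzx : z = g * y * x := by rw [hz, mul_assoc _ g⁻¹ w]
  have hwb : ρ w⁻¹ b ≤ 0 := by
    rw [hwx, mul_inv_rev, rep_mul_apply, hb, map_neg, rep_inv_apply_self, map_neg]
    exact neg_nonpos.mpr (hxpos hd hdP)
  have hzw : cs.length z < cs.length w := (length_reflection_mul_lt_iff hρ hf hbpos hbrefl).mpr hwb
  have hsub : (invSet ρ w ∩ P) \ {b} ⊆ invSet ρ z ∩ P := by
    rintro e ⟨⟨he, heP⟩, heb⟩
    obtain ⟨hep, hew⟩ := (mem_invSet hρ).mp he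
    have her := (mem_posRoots.mp hep).2
    refine ⟨(mem_invSet hρ).mpr ⟨hep, ?_⟩, heP⟩
    have h1 := hinv hg hep heP (hwx ▸ hew)
    have h2 : -ρ g⁻¹ e ∈ posRoots ρ :=
      mem_posRoots.mpr ⟨neg_nonneg.mpr h1, neg_mem_rootSet hρ (rep_mem_rootSet _ her)⟩
    have h2P : -ρ g⁻¹ e ∈ P := P.neg_mem (hDP (inv_mem hg) heP)
    have h3 : 0 ≤ ρ y (-ρ g⁻¹ e) := hperm _ h2 h2P (fun h => heb (by
      rw [Set.mem_singleton_iff, hb, ← h, map_neg, rep_apply_inv_self, neg_neg]))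
    have h4 := hxpos (mem_posRoots.mpr ⟨h3, rep_mem_rootSet _ (mem_posRoots.mp h2).2⟩)
      (hDP hyD h2P)
    rw [map_neg, map_neg] at h4
    rw [hzx, mul_inv_rev _ x, mul_inv_rev g y, rep_mul_apply, rep_mul_apply, hy.inv_eq hρ hf hdr]
    exact neg_nonneg.mp h4
  have hcount : (invSet ρ v ∩ P).encard + 1 ≤ (invSet ρ z ∩ P).encard := by
    have h1 := encard_invSet_inter_reflection_mul hρ hf hc hcP ht hpermC hvc
    have h2 := encard_invSet_inter_reflection_mul hρ hf ha haP hs hpermA hua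
    rw [← hw, h1, ← Set.encard_sdiff_singleton_add_one
      (show b ∈ invSet ρ w ∩ P from ⟨(mem_invSet hρ).mpr ⟨hbpos, hwb⟩, hbP⟩)] at h2
    refine le_trans ?_ (Set.encard_le_encard hsub)
    rw [← ENat.add_le_add_iff_right ENat.one_ne_top, h2]
  have hvz : cs.length v < cs.length z := by
    have hvz_eq : t * cs.simple s * (g * y * g⁻¹) * z = v := by
      rw [hz, mul_assoc, ← mul_assoc _ _ w, hbrefl.mul_self hρ hf (mem_posRoots.mp hbpos).2,
        one_mul, hw, mul_assoc, CoxeterSystem.simple_mul_simple_cancel_left, ← mul_assoc,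
        ht.mul_self hρ hf hcr, one_mul]
    have hodd : Odd (cs.length (t * cs.simple s * (g * y * g⁻¹))) := by
      have h1 := (ht.isReflection hρ hf hcr).odd_length
      have h2 := (hs.isReflection hρ hf har).odd_length
      have h3 := (hbrefl.isReflection hρ hf (mem_posRoots.mp hbpos).2).odd_length
      rw [Nat.odd_iff] at h1 h2 h3 ⊢
      rw [cs.length_mul_mod_two, Nat.add_mod, cs.length_mul_mod_two]
      omega
    obtain ⟨e, he, heP, hte⟩ := exists_isReflIn_of_odd_length hρ hf har hcr haP hcP hs ht
      (mul_mem (mul_mem htD hsD) (mul_mem (mul_mem hg hyD) (inv_mem hg))) hodd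
    rw [← hvz_eq, length_reflection_mul_lt_iff hρ hf he hte]
    by_contra hze
    have h1 := encard_invSet_inter_lt hρ hf he heP hte hze
    rw [hvz_eq] at h1
    have hfin : (invSet ρ v ∩ P).encard ≠ ⊤ :=
      Set.encard_ne_top_iff.mpr ((finite_invSet hρ hf v).inter_of_left _)
    have h2 : (invSet ρ v ∩ P).encard + 1 ≤ (invSet ρ v ∩ P).encard :=
      hcount.trans (le_self_add.trans h1)
    exact absurd h2 (not_le.mpr (ENat.lt_add_one_iff hfin |>.mpr le_rfl))
  refine ⟨b, ⟨hbpos, _, hbrefl, ?_⟩, fun h => hgne (by rw [← h, hb, neg_neg]), hbP⟩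
  rw [← hz]
  omega

end Covers

/-- Let `α ∈ Δ`, `s = s_α`, and `w ∈ W` with `ℓ(sw) < ℓ(w)`.  Then
`N¹(sw) ⊆ {s(β), f_α(β) : β ∈ N¹(w) \ {α}}`, where for `β ∈ Φ⁺ \ {α}` the root
`f_α(β)` is the positive root distinct from `α` such that `{α, f_α(β)}` is the canonical
basis of the maximal rank 2 root subsystem `Φ ∩ P`, `P` being the plane spanned by `α`
and `β` (i.e. `P ∩ Φ⁺ = cone({α, f_α(β)}) ∩ Φ`). -/
theorem nOne_simple_mul_subset {S : Type*} [Fintype S] [DecidableEq S]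
    (Mmat : CoxeterMatrix S) {W : Type*} [Group W] (cs : CoxeterSystem Mmat W)
    (ρ : W →* ((S → ℝ) ≃ₗ[ℝ] (S → ℝ)))
    (hfaith : Function.Injective ρ)
    (hρ : ∀ (s : S) (v : S → ℝ),
      ρ (cs.simple s) v = v - (2 * bform Mmat (simpleRoot s) v) • simpleRoot s)
    (s : S) (w : W) (h : cs.length (cs.simple s * w) < cs.length w) :
    ∀ c ∈ nOne cs ρ (cs.simple s * w),
      ∃ b ∈ nOne cs ρ w, b ≠ simpleRoot s ∧
        (c = ρ (cs.simple s) b ∨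
          (c ∈ posRoots ρ ∧ c ≠ simpleRoot s ∧
            (↑(Submodule.span ℝ {simpleRoot s, b}) ∩ posRoots ρ) =
              coneOf {simpleRoot s, c} ∩ rootSet ρ)) := by
  rintro c ⟨hc, t, ht, htlen⟩
  replace hρ : IsGeometricRep cs ρ := hρ
  obtain ⟨hc0, hcr⟩ := mem_posRoots.mp hc
  have ha : simpleRoot s ∈ posRoots ρ := simpleRoot_mem_posRoots s
  have hs := isReflIn_simple hρ s
  have hswlen : cs.length (cs.simple s * w) + 1 = cs.length w := by
    rcases cs.length_simple_mul w s with h' | h' <;> omega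
  obtain ⟨v, hv⟩ : ∃ v, v = t * (cs.simple s * w) := ⟨_, rfl⟩
  have hu : cs.simple s * w = t * v := by
    rw [hv, ← mul_assoc, ht.mul_self hρ hfaith hcr, one_mul]
  have hw : w = cs.simple s * (t * v) := by
    rw [← hu, CoxeterSystem.simple_mul_simple_cancel_left]
  rw [← hv, hu] at htlen
  rw [hu] at hswlen
  have hcs : c ≠ simpleRoot s := by
    rintro rfl
    rw [ht.unique hfaith hs, CoxeterSystem.simple_mul_simple_cancel_left] at hw
    rw [hw] at hswlen
    omega
  rcases cs.length_simple_mul v s with hsv | hsv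
  · have hb : ρ (cs.simple s) c ∈ posRoots ρ :=
      mem_posRoots.mpr ⟨rep_simple_nonneg hρ hc hcs, rep_mem_rootSet _ hcr⟩
    refine ⟨ρ (cs.simple s) c, ⟨hb, _, ht.conj hρ _, ?_⟩, fun h' => ?_, Or.inl ?_⟩
    · rw [mul_assoc, CoxeterSystem.inv_simple, hu, mul_assoc, ← mul_assoc t,
        ht.mul_self hρ hfaith hcr, one_mul]
      omega
    · have : c = -simpleRoot s := by
        rw [← rep_simple_self hρ, ← h', hs.apply_apply hρ (simpleRoot_mem_rootSet s)]
      exact root_not_nonpos hρ hcr hc0 (this ▸ neg_nonpos.mpr (simpleRoot_nonneg s))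
    · rw [hs.apply_apply hρ (simpleRoot_mem_rootSet s)]
  · have hsv' : ρ v⁻¹ (simpleRoot s) ≤ 0 := by
      rw [← length_reflection_mul_lt_iff hρ hfaith ha hs]
      omega
    have hsu : ¬ ρ (t * v)⁻¹ (simpleRoot s) ≤ 0 := by
      rw [← length_reflection_mul_lt_iff hρ hfaith ha hs, ← hw]
      omega
    have hcan := fun e he heP => exists_nonneg_combination_of_cover hρ hfaith hc hcs ht htlen.symm
      hsv' hsu (e := e) he heP
    obtain ⟨b, hb, hbs, hbP⟩ := exists_mem_nOne_of_canonical hρ hfaith hc hcs ht htlen.symm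
      (by rw [← hw]; omega) hcan
    rw [← hw] at hb
    refine ⟨b, hb, hbs, Or.inr ⟨hc, hcs, ?_⟩⟩
    have hspan : Submodule.span ℝ {simpleRoot s, b} = Submodule.span ℝ {simpleRoot s, c} := by
      obtain ⟨p, q, hpq⟩ := Submodule.mem_span_pair.mp hbP
      have hq : q ≠ 0 := by
        rintro rfl
        exact hbs (posRoot_eq_of_eq_smul hρ hb.1 ha (k := p) (by rw [← hpq]; simp))
      refine le_antisymm (Submodule.span_le.mpr ?_) (Submodule.span_le.mpr ?_)
      · rintro _ (rfl | rfl)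
        · exact Submodule.subset_span (by simp)
        · exact hbP
      · rintro _ (rfl | rfl)
        · exact Submodule.subset_span (by simp)
        · refine Submodule.mem_span_pair.mpr ⟨-(q⁻¹ * p), q⁻¹, ?_⟩
          rw [← hpq, smul_add, smul_smul, smul_smul, inv_mul_cancel₀ hq]
          module
    rw [hspan]
    ext e
    rw [Set.mem_inter_iff, Set.mem_inter_iff, mem_coneOf_pair]
    constructor
    · rintro ⟨heP, he⟩
      exact ⟨hcan e he heP, (mem_posRoots.mp he).2⟩
    · rintro ⟨⟨p, q, hp, hq, rfl⟩, her⟩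
      exact ⟨Submodule.mem_span_pair.mpr ⟨p, q, rfl⟩, mem_posRoots.mpr
        ⟨add_nonneg (smul_nonneg hp (simpleRoot_nonneg s)) (smul_nonneg hq hc0), her⟩⟩
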